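/- Suppose D, β : ℝ² → ℝ are measurable with 0 < D(x) ≤ D_M for all x, β ≥ 0, β integrable on ℝ², and ∫_{ℝ²} β(x) dx > π² D_M / 2. Then there exist L > 0 and a function φ ∈ H₀¹(X_L) on the square X_L = (−L,L)×(−L,L) with ‖φ‖_{L²(X_L)} = 1 and ∫_{X_L} (−D(x)|∇φ(x)|² + β(x)φ(x)²) dx > 0. -/

import Mathlib

open Real MeasureTheory Set

noncomputable def auxF (x : ℝ) : ℝ := (1 - |x|) ^ 5 * (1 + 5 * |x|)
noncomputable def auxG (x : ℝ) : ℝ := -30 * x * (1 - |x|) ^ 4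

lemma auxF_cont : Continuous auxF := by unfold auxF; fun_prop
lemma auxG_cont : Continuous auxG := by unfold auxG; fun_prop

lemma auxF_deriv (x : ℝ) : HasDerivAt auxF (auxG x) x := by
  rcases eq_or_ne x 0 with rfl | hx
  · rw [hasDerivAt_iff_tendsto_slope_zero]
    have h : ∀ t : ℝ, t ≠ 0 → t * (-15 + 40 * |t| - 45 * |t| ^ 2 + 24 * |t| ^ 3 - 5 * |t| ^ 4)
        = t⁻¹ • (auxF (0 + t) - auxF 0) := by
      intro t ht
      have h2 : |t| ^ 2 = t ^ 2 := sq_abs t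
      rw [smul_eq_mul, eq_inv_mul_iff_mul_eq₀ ht]
      simp only [auxF, zero_add, abs_zero]
      linear_combination (-(-15 + 40 * |t| - 45 * |t| ^ 2 + 24 * |t| ^ 3 - 5 * |t| ^ 4)) * h2
    have hc : Continuous fun t : ℝ =>
      t * (-15 + 40 * |t| - 45 * |t| ^ 2 + 24 * |t| ^ 3 - 5 * |t| ^ 4) := by fun_prop
    have := (hc.tendsto 0).mono_left (nhdsWithin_le_nhds (s := {0}ᶜ))
    simp only [zero_mul] at this
    have h0 : auxG 0 = 0 := by simp [auxG]
    rw [h0]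
    refine this.congr' ?_
    filter_upwards [self_mem_nhdsWithin] with t ht using h t ht
  · have ha := hasDerivAt_abs hx
    have h1 := ((ha.const_sub 1).pow 5).mul ((ha.const_mul 5).const_add 1)
    refine (h1.congr_deriv ?_)
    have hs : (SignType.sign x : ℝ) * |x| = x := sign_mul_abs x
    simp only [auxG]
    push_cast
    simp only [Pi.pow_apply]
    linear_combination (-30 * (1 - |x|) ^ 4) * hs

lemma auxF_sq_le (x : ℝ) (hx : |x| ≤ 1) : auxF x ^ 2 ≤ 1 := by
  have h0 := abs_nonneg x
  unfold auxF
  set t := |x|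
  have h1 : 1 + 5 * t ≤ (1 + t) ^ 5 := by
    have := one_add_mul_le_pow (a := t) (by linarith) 5
    simpa using this
  have h2 : 0 ≤ (1 - t) ^ 5 := pow_nonneg (by linarith) _
  have h3 : (1 - t) ^ 5 * (1 + 5 * t) ≤ 1 := by
    calc _ ≤ (1 - t) ^ 5 * (1 + t) ^ 5 := by gcongr
      _ = ((1 - t) * (1 + t)) ^ 5 := by ring
      _ ≤ 1 := pow_le_one₀ (by nlinarith) (by nlinarith)
  exact pow_le_one₀ (by positivity) h3

lemma even_int (g h : ℝ → ℝ) (hh : Continuous g) (he : ∀ x, g (-x) = g x)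
    (hg : ∀ x, 0 ≤ x → x ≤ 1 → g x = h x) (L : ℝ) (hL : 0 < L) :
    ∫ x in Ioo (-L) L, g (x / L) = L * (2 * ∫ x in (0:ℝ)..1, h x) := by
  rw [← integral_Ioc_eq_integral_Ioo, ← intervalIntegral.integral_of_le (by linarith),
    intervalIntegral.integral_comp_div g hL.ne', smul_eq_mul]
  congr 1
  rw [neg_div, div_self hL.ne',
    ← intervalIntegral.integral_add_adjacent_intervals (b := 0)
      (hh.intervalIntegrable _ _) (hh.intervalIntegrable _ _)]
  have e1 : ∫ x in (-1:ℝ)..0, g x = ∫ x in (0:ℝ)..1, g x := by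
    have := intervalIntegral.integral_comp_neg (a := 0) (b := 1) g
    simp only [he, neg_zero] at this
    exact this.symm
  have e2 : ∫ x in (0:ℝ)..1, g x = ∫ x in (0:ℝ)..1, h x := by
    apply intervalIntegral.integral_congr
    intro x hx
    rw [uIcc_of_le zero_le_one] at hx
    exact hg x hx.1 hx.2
  rw [e1, e2]; ring

lemma int_of_deriv (p q : ℝ → ℝ) (hq : Continuous q) (h : ∀ x, HasDerivAt p (q x) x) :
    ∫ x in (0:ℝ)..1, q x = p 1 - p 0 :=
  intervalIntegral.integral_eq_sub_of_hasDerivAt (fun x _ => h x) (hq.intervalIntegrable _ _)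

lemma dpow (n : ℕ) (x : ℝ) :
    HasDerivAt (fun x : ℝ => (1 - x) ^ n) (-(n * (1 - x) ^ (n - 1))) x := by
  have := ((hasDerivAt_id x).const_sub 1).pow n
  refine this.congr_deriv ?_
  simp

lemma intB (L : ℝ) (hL : 0 < L) : ∫ x in Ioo (-L) L, auxF (x / L) ^ 2 = L * (56 / 143) := by
  rw [even_int (fun x => auxF x ^ 2) (fun x => ((1 - x) ^ 5 * (1 + 5 * x)) ^ 2)
    (auxF_cont.pow 2) (by simp [auxF]) (by intro x h _; simp [auxF, abs_of_nonneg h]) L hL]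
  rw [int_of_deriv (fun x => -(36/11) * (1 - x) ^ 11 + 5 * (1 - x) ^ 12 - 25/13 * (1 - x) ^ 13)]
  · norm_num
  · fun_prop
  · intro x
    refine ((((dpow 11 x).const_mul _).add ((dpow 12 x).const_mul _)).sub
      ((dpow 13 x).const_mul _)).congr_deriv ?_
    push_cast
    norm_num
    ring

lemma intA (L : ℝ) (hL : 0 < L) : ∫ x in Ioo (-L) L, auxG (x / L) ^ 2 = L * (40 / 11) := by
  rw [even_int (fun x => auxG x ^ 2) (fun x => (-30 * x * (1 - x) ^ 4) ^ 2)
    (auxG_cont.pow 2) (by intro x; simp [auxG])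
    (by intro x h _; simp only [auxG, abs_of_nonneg h]) L hL]
  rw [int_of_deriv (fun x => -100 * (1 - x) ^ 9 + 180 * (1 - x) ^ 10 - 900/11 * (1 - x) ^ 11)]
  · norm_num
  · fun_prop
  · intro x
    refine ((((dpow 9 x).const_mul _).add ((dpow 10 x).const_mul _)).sub
      ((dpow 11 x).const_mul _)).congr_deriv ?_
    push_cast
    norm_num
    ring

lemma intC (L : ℝ) (hL : 0 < L) :
    ∫ x in Ioo (-L) L, |auxF (x / L) * auxG (x / L)| = L * 1 := by
  rw [even_int (fun x => |auxF x * auxG x|)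
    (fun x => ((1 - x) ^ 5 * (1 + 5 * x)) * (30 * x * (1 - x) ^ 4))
    (auxF_cont.mul auxG_cont).abs (by intro x; simp [auxF, auxG, abs_mul])
    (by
      intro x h h1
      have h2 : 0 ≤ 1 - x := by linarith
      have : auxF x * auxG x = -(((1 - x) ^ 5 * (1 + 5 * x)) * (30 * x * (1 - x) ^ 4)) := by
        simp only [auxG, auxF, abs_of_nonneg h]; ring
      simp only [this, abs_neg]
      exact abs_of_nonneg (by positivity)) L hL]
  rw [int_of_deriv (fun x => -(1/2) * (6 * (1 - x) ^ 5 - 5 * (1 - x) ^ 6) ^ 2)]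
  · norm_num
  · fun_prop
  · intro x
    refine (((((dpow 5 x).const_mul 6).sub ((dpow 6 x).const_mul 5)).pow 2).const_mul
      _).congr_deriv ?_
    simp
    ring

lemma int_mul (L : ℝ) (u v : ℝ → ℝ) :
    ∫ x in Ioo (-L) L ×ˢ Ioo (-L) L, u x.1 * v x.2 =
      (∫ x in Ioo (-L) L, u x) * ∫ x in Ioo (-L) L, v x :=
  setIntegral_prod_mul u v _ _

lemma int_cont (L : ℝ) (u : ℝ × ℝ → ℝ) (hu : Continuous u) :
    IntegrableOn u (Ioo (-L) L ×ˢ Ioo (-L) L) :=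
  (hu.continuousOn.integrableOn_compact (isCompact_Icc.prod isCompact_Icc)).mono_set
    (prod_mono Ioo_subset_Icc_self Ioo_subset_Icc_self)

lemma choose_L (β : ℝ × ℝ → ℝ) (hβmeas : Measurable β) (hβ : ∀ x, 0 ≤ β x)
    (hβint : Integrable β) (c : ℝ) (hc : c < ∫ x, β x) :
    ∃ L > (0 : ℝ), c < ∫ x in Ioo (-L) L ×ˢ Ioo (-L) L,
      β x * (auxF (x.1 / L) ^ 2 * auxF (x.2 / L) ^ 2) := by
  have hm : ∀ L : ℝ, MeasurableSet (Ioo (-L) L ×ˢ Ioo (-L) L : Set (ℝ × ℝ)) :=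
    fun L => measurableSet_Ioo.prod measurableSet_Ioo
  have hF := auxF_cont
  have key : Filter.Tendsto (fun L : ℝ => ∫ x, (Ioo (-L) L ×ˢ Ioo (-L) L).indicator
      (fun x : ℝ × ℝ => β x * (auxF (x.1 / L) ^ 2 * auxF (x.2 / L) ^ 2)) x)
      Filter.atTop (nhds (∫ x, β x)) := by
    apply tendsto_integral_filter_of_dominated_convergence β
    · refine Filter.Eventually.of_forall fun L => ?_
      refine (Measurable.indicator ?_ (hm L)).aestronglyMeasurable
      exact hβmeas.mul (by fun_prop : Continuous fun x : ℝ × ℝ =>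
        auxF (x.1 / L) ^ 2 * auxF (x.2 / L) ^ 2).measurable
    · refine Filter.Eventually.of_forall fun L => Filter.Eventually.of_forall fun x => ?_
      by_cases hx : x ∈ (Ioo (-L) L ×ˢ Ioo (-L) L : Set (ℝ × ℝ))
      · rw [indicator_of_mem hx]
        obtain ⟨⟨a1, a2⟩, ⟨b1, b2⟩⟩ := hx
        have hL : 0 < L := by linarith
        have h1 : auxF (x.1 / L) ^ 2 ≤ 1 := auxF_sq_le _ (by
          rw [abs_div, abs_of_pos hL, div_le_one hL]; exact (abs_lt.2 ⟨a1, a2⟩).le)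
        have h2 : auxF (x.2 / L) ^ 2 ≤ 1 := auxF_sq_le _ (by
          rw [abs_div, abs_of_pos hL, div_le_one hL]; exact (abs_lt.2 ⟨b1, b2⟩).le)
        rw [Real.norm_of_nonneg (mul_nonneg (hβ x) (by positivity))]
        exact mul_le_of_le_one_right (hβ x) (mul_le_one₀ h1 (by positivity) h2)
      · rw [indicator_of_notMem hx]; simpa using hβ x
    · exact hβint
    · refine Filter.Eventually.of_forall fun x => ?_
      have ht : ∀ a : ℝ, Filter.Tendsto (fun L : ℝ => auxF (a / L) ^ 2) Filter.atTop (nhds 1) := by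
        intro a
        have h0 : Filter.Tendsto (fun L : ℝ => a / L) Filter.atTop (nhds 0) :=
          Filter.tendsto_id.const_div_atTop a
        have := ((hF.tendsto 0).comp h0).pow 2
        simpa [auxF] using this
      have h3 := ((ht x.1).mul (ht x.2)).const_mul (β x)
      simp only [mul_one] at h3
      refine h3.congr' ?_
      filter_upwards [Filter.eventually_gt_atTop |x.1|, Filter.eventually_gt_atTop |x.2|]
        with L h1 h2
      rw [indicator_of_mem]
      exact ⟨abs_lt.1 h1, abs_lt.1 h2⟩
  obtain ⟨L, h1, h2⟩ := ((key.eventually (lt_mem_nhds hc)).and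
    (Filter.eventually_gt_atTop 0)).exists
  refine ⟨L, h2, ?_⟩
  rwa [integral_indicator (hm L)] at h1

/-- If the total birth rate exceeds π² D_M / 2, there is a square X_L and a
function φ in H₀¹(X_L) (expressed here as: φ differentiable on ℝ² and vanishing
on the boundary of the square) with unit L² norm making the Rayleigh quotient
positive. -/
theorem stmt_4 (D β : ℝ × ℝ → ℝ) (D_M : ℝ) (hDM : 0 < D_M)
    (hDmeas : Measurable D) (hβmeas : Measurable β)
    (hD : ∀ x, 0 < D x ∧ D x ≤ D_M)
    (hβ : ∀ x, 0 ≤ β x)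
    (hβint : Integrable β)
    (hmass : ∫ x, β x > π ^ 2 * D_M / 2) :
    ∃ L > (0 : ℝ), ∃ φ : ℝ × ℝ → ℝ,
      Differentiable ℝ φ ∧
      (∀ x ∈ frontier (Set.Ioo (-L) L ×ˢ Set.Ioo (-L) L), φ x = 0) ∧
      (∫ x in (Set.Ioo (-L) L ×ˢ Set.Ioo (-L) L), (φ x) ^ 2) = 1 ∧
      (∫ x in (Set.Ioo (-L) L ×ˢ Set.Ioo (-L) L),
          (-(D x) * ‖fderiv ℝ φ x‖ ^ 2 + β x * (φ x) ^ 2)) > 0 := by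
  obtain ⟨L, hL, hint⟩ := choose_L β hβmeas hβ hβint _ hmass
  have hF := auxF_cont
  have hG := auxG_cont
  obtain ⟨k, hk⟩ : ∃ k : ℝ, k = 1 / (L * (56 / 143)) := ⟨_, rfl⟩
  have hk0 : 0 < k := by rw [hk]; positivity
  have hkL : k * (L * (56 / 143)) = 1 := by rw [hk]; field_simp
  set X : Set (ℝ × ℝ) := Ioo (-L) L ×ˢ Ioo (-L) L with hX
  have hXm : MeasurableSet X := measurableSet_Ioo.prod measurableSet_Ioo
  set φ : ℝ × ℝ → ℝ := fun x => k * (auxF (x.1 / L) * auxF (x.2 / L)) with hφ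
  have hφc : Continuous φ := by fun_prop
  have hd1 : ∀ x : ℝ × ℝ, HasFDerivAt (fun x : ℝ × ℝ => auxF (x.1 / L))
      ((auxG (x.1 / L) / L) • ContinuousLinearMap.fst ℝ ℝ ℝ) x := by
    intro x
    have h1 : HasDerivAt (fun t : ℝ => auxF (t / L)) (auxG (x.1 / L) * (1 / L)) x.1 :=
      HasDerivAt.comp (h := fun t : ℝ => t / L) x.1 (auxF_deriv (x.1 / L))
        ((hasDerivAt_id' x.1).div_const L)
    rw [mul_one_div] at h1
    exact h1.comp_hasFDerivAt x hasFDerivAt_fst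
  have hd2 : ∀ x : ℝ × ℝ, HasFDerivAt (fun x : ℝ × ℝ => auxF (x.2 / L))
      ((auxG (x.2 / L) / L) • ContinuousLinearMap.snd ℝ ℝ ℝ) x := by
    intro x
    have h1 : HasDerivAt (fun t : ℝ => auxF (t / L)) (auxG (x.2 / L) * (1 / L)) x.2 :=
      HasDerivAt.comp (h := fun t : ℝ => t / L) x.2 (auxF_deriv (x.2 / L))
        ((hasDerivAt_id' x.2).div_const L)
    rw [mul_one_div] at h1
    exact h1.comp_hasFDerivAt x hasFDerivAt_snd
  have hd := fun x => ((hd1 x).mul (hd2 x)).const_mul k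
  set G : ℝ × ℝ → ℝ := fun x => (k / L) ^ 2 *
    (auxF (x.1 / L) ^ 2 * auxG (x.2 / L) ^ 2 + auxG (x.1 / L) ^ 2 * auxF (x.2 / L) ^ 2
      + 2 * (|auxF (x.1 / L) * auxG (x.1 / L)| * |auxF (x.2 / L) * auxG (x.2 / L)|)) with hGdef
  have hGc : Continuous G := by fun_prop
  have hbound : ∀ x, ‖fderiv ℝ φ x‖ ^ 2 ≤ G x := by
    intro x
    have e : fderiv ℝ φ x = _ := (hd x).fderiv
    rw [e]
    set a := auxF (x.1 / L)
    set b := auxF (x.2 / L)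
    set a' := auxG (x.1 / L)
    set b' := auxG (x.2 / L)
    have h1 : ‖k • (a • (b' / L) • ContinuousLinearMap.snd ℝ ℝ ℝ
        + b • (a' / L) • ContinuousLinearMap.fst ℝ ℝ ℝ)‖ ≤
        k * (|a| * (|b'| / L) + |b| * (|a'| / L)) := by
      rw [norm_smul, Real.norm_of_nonneg hk0.le]
      gcongr
      refine (norm_add_le _ _).trans ?_
      simp only [norm_smul, Real.norm_eq_abs, abs_div, abs_of_pos hL]
      gcongr
      · exact mul_le_of_le_one_right (by positivity) (ContinuousLinearMap.norm_snd_le ..)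
      · exact mul_le_of_le_one_right (by positivity) (ContinuousLinearMap.norm_fst_le ..)
    refine (pow_le_pow_left₀ (norm_nonneg _) h1 2).trans (le_of_eq ?_)
    simp only [hGdef, abs_mul]
    rw [← sq_abs (auxF (x.1 / L)), ← sq_abs (auxF (x.2 / L)), ← sq_abs (auxG (x.1 / L)),
      ← sq_abs (auxG (x.2 / L))]
    field_simp
    ring
  have hGint : ∫ x in X, G x = k ^ 2 * (2 * (40 / 11) * (56 / 143) + 2) := by
    simp only [hGdef]
    rw [integral_const_mul, integral_add, integral_add, integral_const_mul]
    · rw [hX, int_mul L (fun t => auxF (t / L) ^ 2) (fun t => auxG (t / L) ^ 2),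
        int_mul L (fun t => auxG (t / L) ^ 2) (fun t => auxF (t / L) ^ 2),
        int_mul L (fun t => |auxF (t / L) * auxG (t / L)|)
          (fun t => |auxF (t / L) * auxG (t / L)|), intA L hL, intB L hL, intC L hL]
      field_simp
      ring
    all_goals exact int_cont L _ (by fun_prop)
  have hDi : IntegrableOn (fun x => D x * ‖fderiv ℝ φ x‖ ^ 2) X := by
    refine Integrable.mono' ((int_cont L _ hGc).const_mul D_M) ?_ ?_
    · exact (hDmeas.mul ((measurable_fderiv ℝ φ).norm.pow_const 2)).aestronglyMeasurable
    · refine Filter.Eventually.of_forall fun x => ?_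
      rw [Real.norm_of_nonneg (mul_nonneg (hD x).1.le (by positivity))]
      exact mul_le_mul (hD x).2 (hbound x) (by positivity) hDM.le
  have hDle : ∫ x in X, D x * ‖fderiv ℝ φ x‖ ^ 2 ≤
      D_M * (k ^ 2 * (2 * (40 / 11) * (56 / 143) + 2)) := by
    rw [← hGint, ← integral_const_mul]
    refine integral_mono hDi ((int_cont L _ hGc).const_mul D_M) fun x => ?_
    exact mul_le_mul (hD x).2 (hbound x) (by positivity) hDM.le
  have hpi : (0:ℝ) < π ^ 2 * D_M / 2 := by positivity
  have hβφ : ∀ x, β x * φ x ^ 2 =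
      k ^ 2 * (β x * (auxF (x.1 / L) ^ 2 * auxF (x.2 / L) ^ 2)) := by
    intro x; simp only [hφ]; ring
  have hβi : IntegrableOn (fun x => β x * φ x ^ 2) X := by
    simp only [hβφ]
    refine Integrable.const_mul ?_ _
    by_contra hn
    rw [integral_undef hn] at hint
    linarith
  refine ⟨L, hL, φ, fun x => (hd x).differentiableAt, ?_, ?_, ?_⟩
  · intro x hx
    have hf1 : auxF 1 = 0 := by simp [auxF]
    have hf2 : auxF (-1) = 0 := by simp [auxF]
    have hz : ∀ t, t ∈ frontier (Ioo (-L) L) → auxF (t / L) = 0 := by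
      intro t ht
      rw [frontier_Ioo (by linarith)] at ht
      rcases ht with rfl | rfl
      · rw [neg_div, div_self hL.ne', hf2]
      · rw [div_self hL.ne', hf1]
    rw [frontier_prod_eq] at hx
    rcases hx with ⟨_, h⟩ | ⟨h, _⟩
    · simp [hφ, hz _ h]
    · simp [hφ, hz _ h]
  · have : ∀ x, φ x ^ 2 = k ^ 2 * (auxF (x.1 / L) ^ 2 * auxF (x.2 / L) ^ 2) := by
      intro x; simp only [hφ]; ring
    simp only [this]
    rw [integral_const_mul,
      int_mul L (fun t => auxF (t / L) ^ 2) (fun t => auxF (t / L) ^ 2), intB L hL]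
    calc _ = (k * (L * (56 / 143))) ^ 2 := by ring
      _ = 1 := by rw [hkL]; norm_num
  · have e : ∫ x in X, (-(D x) * ‖fderiv ℝ φ x‖ ^ 2 + β x * (φ x) ^ 2) =
        -(∫ x in X, D x * ‖fderiv ℝ φ x‖ ^ 2) + ∫ x in X, β x * φ x ^ 2 := by
      rw [← integral_neg]
      simp only [neg_mul]
      exact integral_add hDi.neg hβi
    rw [e]
    have e2 : ∫ x in X, β x * φ x ^ 2 = k ^ 2 *
        ∫ x in X, β x * (auxF (x.1 / L) ^ 2 * auxF (x.2 / L) ^ 2) := by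
      simp only [hβφ]; rw [integral_const_mul]
    rw [e2]
    have hp : (9.859 : ℝ) < π ^ 2 := by nlinarith [Real.pi_gt_d2]
    have h3 : D_M * (2 * (40 / 11) * (56 / 143) + 2) <
        ∫ x in X, β x * (auxF (x.1 / L) ^ 2 * auxF (x.2 / L) ^ 2) := by
      nlinarith
    have h4 := mul_lt_mul_of_pos_left h3 (pow_pos hk0 2)
    linarith
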